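/- arXiv:0812.1351 — 2 statements merged into one kernel-verified Lean document; each statement's English description precedes it below -/
import Mathlib

section
/- Let F, G : ℝ³ → ℝ be smooth and suppose the feedback transformation (X,U) relates G to F on an open set D ⊆ ℝ³. Then for every p = (x,u,u₁) ∈ D, the second-order transformation law F_{u₁u₁}(Φ̃(p))·W(p)³ = X'(x)·U_u(x,u)·G_{u₁u₁}(p) holds. -/
noncomputable section

/-- Directional (partial) derivative of a function on `ℝ³ = ℝ × ℝ × ℝ`
(coordinates `(x, u, u₁)`) in the direction `v`. -/
def pd (H : ℝ × ℝ × ℝ → ℝ) (v : ℝ × ℝ × ℝ) : ℝ × ℝ × ℝ → ℝ :=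
  fun p => fderiv ℝ H p v

/-- The coordinate direction `∂/∂x`. -/
def dx : ℝ × ℝ × ℝ := (1, 0, 0)

/-- The coordinate direction `∂/∂u`. -/
def du : ℝ × ℝ × ℝ := (0, 1, 0)

/-- The coordinate direction `∂/∂u₁`. -/
def du1 : ℝ × ℝ × ℝ := (0, 0, 1)

/-- `U_x`, the partial derivative of `U(x,u)` in the first variable. -/
def Ux (U : ℝ × ℝ → ℝ) : ℝ × ℝ → ℝ := fun q => fderiv ℝ U q (1, 0)

/-- `U_u`, the partial derivative of `U(x,u)` in the second variable. -/
def Uu (U : ℝ × ℝ → ℝ) : ℝ × ℝ → ℝ := fun q => fderiv ℝ U q (0, 1)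

/-- The feedback transformation `(X, U)` relates `G` to `F` on `D`:
`X'(x)·G(x,u,u₁) = F(X x, U (x,u), U_x·G + U_u·u₁)` for all `(x,u,u₁) ∈ D`. -/
def Relates (X : ℝ → ℝ) (U : ℝ × ℝ → ℝ) (G F : ℝ × ℝ × ℝ → ℝ) (D : Set (ℝ × ℝ × ℝ)) : Prop :=
  ∀ p ∈ D, deriv X p.1 * G p =
    F (X p.1, U (p.1, p.2.1), Ux U (p.1, p.2.1) * G p + Uu U (p.1, p.2.1) * p.2.2)

/-- The prolongation `Φ̃(x,u,u₁) = (X x, U (x,u), U_x·G + U_u·u₁)`. -/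
def Prol (X : ℝ → ℝ) (U : ℝ × ℝ → ℝ) (G : ℝ × ℝ × ℝ → ℝ) : ℝ × ℝ × ℝ → ℝ × ℝ × ℝ :=
  fun p => (X p.1, U (p.1, p.2.1), Ux U (p.1, p.2.1) * G p + Uu U (p.1, p.2.1) * p.2.2)

/-- `W(x,u,u₁) = U_x(x,u)·G_{u₁}(x,u,u₁) + U_u(x,u)`. -/
def Wfun (U : ℝ × ℝ → ℝ) (G : ℝ × ℝ × ℝ → ℝ) : ℝ × ℝ × ℝ → ℝ :=
  fun p => Ux U (p.1, p.2.1) * pd G du1 p + Uu U (p.1, p.2.1)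

/-- The partial derivative `∂H/∂u₁` is the derivative of `H` along the third coordinate line. -/
lemma hasDerivAt_pd_du1 {H : ℝ × ℝ × ℝ → ℝ} (hH : Differentiable ℝ H) (x u t : ℝ) :
    HasDerivAt (fun s => H (x, u, s)) (pd H du1 (x, u, t)) t :=
  (hH (x, u, t)).hasFDerivAt.comp_hasDerivAt t
    ((hasDerivAt_const t x).prodMk ((hasDerivAt_const t u).prodMk (hasDerivAt_id t)))

/-- Partial derivatives of smooth functions are differentiable. -/
lemma differentiable_pd {H : ℝ × ℝ × ℝ → ℝ} (hH : ContDiff ℝ (⊤ : ℕ∞) H) (v : ℝ × ℝ × ℝ) :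
    Differentiable ℝ (pd H v) :=
  ((hH.fderiv_right (m := 1) (by norm_cast)).differentiable (by norm_num)).clm_apply
    (differentiable_const v)

/-- Implicit differentiation of `a * g t = f (b * g t + c * t)` to second order. -/
lemma second_deriv_of_mul_eq_comp {f f' g g' : ℝ → ℝ} {a b c t f'' g'' : ℝ}
    (hf : ∀ s, HasDerivAt f (f' s) s) (hg : ∀ s, HasDerivAt g (g' s) s)
    (hf' : HasDerivAt f' f'' (b * g t + c * t)) (hg' : HasDerivAt g' g'' t)
    (h : ∀ᶠ s in nhds t, a * g s = f (b * g s + c * s)) :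
    f'' * (b * g' t + c) ^ 3 = a * c * g'' := by
  have inner (s : ℝ) : HasDerivAt (fun r => b * g r + c * r) (b * g' s + c) s := by
    simpa using ((hg s).const_mul b).fun_add ((hasDerivAt_id s).const_mul c)
  have first : ∀ᶠ s in nhds t, a * g' s = f' (b * g s + c * s) * (b * g' s + c) := by
    filter_upwards [h.eventually_nhds] with s hs
    exact ((hg s).const_mul a).unique
      (((hf _).comp s (inner s)).congr_of_eventuallyEq hs)
  have second : a * g'' =
      f'' * (b * g' t + c) * (b * g' t + c) + f' (b * g t + c * t) * (b * g'') :=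
    (hg'.const_mul a).unique
      (((hf'.comp t (inner t)).mul ((hg'.const_mul b).add_const c)).congr_of_eventuallyEq first)
  linear_combination (-(b * g' t + c)) * second + b * g'' * first.self_of_nhds

/-- second-order transformation law
`F_{u₁u₁}(Φ̃(p))·W(p)³ = X'(x)·U_u(x,u)·G_{u₁u₁}(p)` for a feedback
transformation relating `G` to `F` on an open set `D`. -/
theorem second_order_transformation_law
    (F G : ℝ × ℝ × ℝ → ℝ) (X : ℝ → ℝ) (U : ℝ × ℝ → ℝ)
    (hF : ContDiff ℝ (⊤ : ℕ∞) F) (hG : ContDiff ℝ (⊤ : ℕ∞) G)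
    (hX : ContDiff ℝ (⊤ : ℕ∞) X) (hU : ContDiff ℝ (⊤ : ℕ∞) U)
    (hX' : ∀ x, deriv X x ≠ 0) (hUu : ∀ q, Uu U q ≠ 0)
    (D : Set (ℝ × ℝ × ℝ)) (hD : IsOpen D)
    (hrel : Relates X U G F D) :
    ∀ p ∈ D,
      pd (pd F du1) du1 (Prol X U G p) * Wfun U G p ^ 3
        = deriv X p.1 * Uu U (p.1, p.2.1) * pd (pd G du1) du1 p := by
  rintro ⟨x, u, t⟩ hp
  have line : Filter.Tendsto (fun s : ℝ => (x, u, s)) (nhds t) (nhds (x, u, t)) :=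
    Continuous.tendsto (by fun_prop) t
  refine second_deriv_of_mul_eq_comp
    (hasDerivAt_pd_du1 (hF.differentiable (by simp)) (X x) (U (x, u)))
    (hasDerivAt_pd_du1 (hG.differentiable (by simp)) x u)
    (hasDerivAt_pd_du1 (differentiable_pd hF du1) (X x) (U (x, u)) _)
    (hasDerivAt_pd_du1 (differentiable_pd hG du1) x u t) ?_
  filter_upwards [line.eventually (hD.mem_nhds hp)] with s hs
  exact hrel (x, u, s) hs
end
end

section
/- Let F : ℝ³ → ℝ be smooth and let D ⊆ ℝ³ be an open set on which F ≠ 0, F_{u₁} ≠ 0, F_{u₁u₁} ≠ 0 and u₁·F_{u₁} − F ≠ 0. Then there exists a smooth function L : D → ℝ such that on D the commutation relation [∇₃^F, ∇₂^F] = −∇₃^F + J^F·∇₁^F + L·∇₂^F holds, where J^F = F²·F_{u₁u₁} / ((u₁·F_{u₁} − F)·F_{u₁}²). -/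
noncomputable section

/-- The basic second-order feedback differential invariant
`J^H = H²·H_{u₁u₁} / ((u₁·H_{u₁} − H)·H_{u₁}²)`. -/
def Jinv (H : ℝ × ℝ × ℝ → ℝ) : ℝ × ℝ × ℝ → ℝ :=
  fun p => H p ^ 2 * pd (pd H du1) du1 p / ((p.2.2 * pd H du1 p - H p) * pd H du1 p ^ 2)

/-- The feedback invariant derivation
`∇₁^H = (0, (u₁·H_{u₁} − H)/H_{u₁}, (H − u₁·H_{u₁})·H_u/H_{u₁}²)`. -/
def nabla1 (H : ℝ × ℝ × ℝ → ℝ) : ℝ × ℝ × ℝ → ℝ × ℝ × ℝ := fun p =>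
  (0, (p.2.2 * pd H du1 p - H p) / pd H du1 p,
    (H p - p.2.2 * pd H du1 p) * pd H du p / pd H du1 p ^ 2)

/-- The feedback invariant derivation `∇₂^H = (0, 0, H/H_{u₁})`. -/
def nabla2 (H : ℝ × ℝ × ℝ → ℝ) : ℝ × ℝ × ℝ → ℝ × ℝ × ℝ := fun p =>
  (0, 0, H p / pd H du1 p)

/-- The feedback invariant derivation
`∇₃^H = (H, H/H_{u₁}, (H_x H_{u₁} + H_u − u₁ H_{uu₁} − H_{xu₁})/H_{u₁u₁}
          + ((u₁ H_{u₁} − H)/H_{u₁}²)·H_u)`. -/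
def nabla3 (H : ℝ × ℝ × ℝ → ℝ) : ℝ × ℝ × ℝ → ℝ × ℝ × ℝ := fun p =>
  (H p, H p / pd H du1 p,
    (pd H dx p * pd H du1 p + pd H du p - p.2.2 * pd (pd H du) du1 p - pd (pd H dx) du1 p)
        / pd (pd H du1) du1 p
      + ((p.2.2 * pd H du1 p - H p) / pd H du1 p ^ 2) * pd H du p)

/-- Lie bracket of vector fields on (an open subset of) `ℝ³`:
`[V,W](p) = DW(p)·V(p) − DV(p)·W(p)`. -/
def lie (V W : ℝ × ℝ × ℝ → ℝ × ℝ × ℝ) : ℝ × ℝ × ℝ → ℝ × ℝ × ℝ :=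
  fun p => fderiv ℝ W p (V p) - fderiv ℝ V p (W p)

theorem ContDiff.pd {H : ℝ × ℝ × ℝ → ℝ} (hH : ContDiff ℝ (⊤ : ℕ∞) H) (v : ℝ × ℝ × ℝ) :
    ContDiff ℝ (⊤ : ℕ∞) (pd H v) :=
  (hH.fderiv_right (m := (⊤ : ℕ∞)) (by simp)).clm_apply contDiff_const

theorem contDiffOn_Jinv {F : ℝ × ℝ × ℝ → ℝ} (hF : ContDiff ℝ (⊤ : ℕ∞) F)
    {D : Set (ℝ × ℝ × ℝ)} (h1 : ∀ p ∈ D, pd F du1 p ≠ 0)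
    (h3 : ∀ p ∈ D, p.2.2 * pd F du1 p - F p ≠ 0) :
    ContDiffOn ℝ (⊤ : ℕ∞) (Jinv F) D := by
  have f1 := hF.pd du1
  have f11 := f1.pd du1
  exact ContDiffOn.div (by fun_prop) (by fun_prop)
    fun p hp => mul_ne_zero (h3 p hp) (pow_ne_zero 2 (h1 p hp))

theorem contDiffOn_nabla1 {F : ℝ × ℝ × ℝ → ℝ} (hF : ContDiff ℝ (⊤ : ℕ∞) F)
    {D : Set (ℝ × ℝ × ℝ)} (h1 : ∀ p ∈ D, pd F du1 p ≠ 0) :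
    ContDiffOn ℝ (⊤ : ℕ∞) (nabla1 F) D := by
  have f1 := hF.pd du1
  have fu := hF.pd du
  exact contDiffOn_const.prodMk (ContDiffOn.prodMk
    (ContDiffOn.div (by fun_prop) (by fun_prop) h1)
    (ContDiffOn.div (by fun_prop) (by fun_prop) fun p hp => pow_ne_zero 2 (h1 p hp)))

theorem contDiffOn_nabla2 {F : ℝ × ℝ × ℝ → ℝ} (hF : ContDiff ℝ (⊤ : ℕ∞) F)
    {D : Set (ℝ × ℝ × ℝ)} (h1 : ∀ p ∈ D, pd F du1 p ≠ 0) :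
    ContDiffOn ℝ (⊤ : ℕ∞) (nabla2 F) D :=
  contDiffOn_const.prodMk (contDiffOn_const.prodMk
    (hF.contDiffOn.div (hF.pd du1).contDiffOn h1))

theorem contDiffOn_nabla3 {F : ℝ × ℝ × ℝ → ℝ} (hF : ContDiff ℝ (⊤ : ℕ∞) F)
    {D : Set (ℝ × ℝ × ℝ)} (h1 : ∀ p ∈ D, pd F du1 p ≠ 0)
    (h2 : ∀ p ∈ D, pd (pd F du1) du1 p ≠ 0) :
    ContDiffOn ℝ (⊤ : ℕ∞) (nabla3 F) D := by
  have f1 := hF.pd du1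
  have fu := hF.pd du
  have fx := hF.pd dx
  have f11 := f1.pd du1
  have fu1 := fu.pd du1
  have fx1 := fx.pd du1
  exact hF.contDiffOn.prodMk (ContDiffOn.prodMk
    (hF.contDiffOn.div f1.contDiffOn h1)
    (ContDiffOn.add (ContDiffOn.div (by fun_prop) f11.contDiffOn h2)
      (ContDiffOn.mul (ContDiffOn.div (by fun_prop) (by fun_prop)
        fun p hp => pow_ne_zero 2 (h1 p hp)) fu.contDiffOn)))

theorem contDiffOn_lie {V W : ℝ × ℝ × ℝ → ℝ × ℝ × ℝ} {D : Set (ℝ × ℝ × ℝ)} (hD : IsOpen D)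
    (hV : ContDiffOn ℝ (⊤ : ℕ∞) V D) (hW : ContDiffOn ℝ (⊤ : ℕ∞) W D) :
    ContDiffOn ℝ (⊤ : ℕ∞) (lie V W) D :=
  ((hW.fderiv_of_isOpen hD (m := (⊤ : ℕ∞)) (by simp)).clm_apply hV).sub
    ((hV.fderiv_of_isOpen hD (m := (⊤ : ℕ∞)) (by simp)).clm_apply hW)

theorem fderiv_fst_comp_apply {E F G : Type*} [NormedAddCommGroup E] [NormedSpace ℝ E]
    [NormedAddCommGroup F] [NormedSpace ℝ F] [NormedAddCommGroup G] [NormedSpace ℝ G]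
    {f : E → F × G} {p : E} (hf : DifferentiableAt ℝ f p) (v : E) :
    (fderiv ℝ f p v).1 = fderiv ℝ (fun q => (f q).1) p v := by
  rw [fderiv.fst hf]; rfl

theorem fderiv_snd_comp_apply {E F G : Type*} [NormedAddCommGroup E] [NormedSpace ℝ E]
    [NormedAddCommGroup F] [NormedSpace ℝ F] [NormedAddCommGroup G] [NormedSpace ℝ G]
    {f : E → F × G} {p : E} (hf : DifferentiableAt ℝ f p) (v : E) :
    (fderiv ℝ f p v).2 = fderiv ℝ (fun q => (f q).2) p v := by
  rw [fderiv.snd hf]; rfl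

theorem nabla2_eq_smul (F : ℝ × ℝ × ℝ → ℝ) (p : ℝ × ℝ × ℝ) :
    nabla2 F p = (F p / pd F du1 p) • du1 := by
  simp [nabla2, du1]

theorem lie_nabla3_nabla2_fst {F : ℝ × ℝ × ℝ → ℝ} {p : ℝ × ℝ × ℝ}
    (h3 : DifferentiableAt ℝ (nabla3 F) p) (h2 : DifferentiableAt ℝ (nabla2 F) p)
    (h1 : pd F du1 p ≠ 0) :
    (lie (nabla3 F) (nabla2 F) p).1 = -F p := by
  have e2 : (fun q => (nabla2 F q).1) = fun _ => (0 : ℝ) := rfl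
  have e3 : (fun q => (nabla3 F q).1) = F := rfl
  rw [lie, Prod.fst_sub, fderiv_fst_comp_apply h2, fderiv_fst_comp_apply h3, e2, e3,
    nabla2_eq_smul, map_smul]
  change fderiv ℝ (fun _ => (0 : ℝ)) p _ - (F p / pd F du1 p) * pd F du1 p = _
  simp [h1]

theorem lie_nabla3_nabla2_snd_fst {F : ℝ × ℝ × ℝ → ℝ} {p : ℝ × ℝ × ℝ}
    (hF : ContDiff ℝ (⊤ : ℕ∞) F)
    (h3 : DifferentiableAt ℝ (nabla3 F) p) (h2 : DifferentiableAt ℝ (nabla2 F) p)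
    (h1 : pd F du1 p ≠ 0) :
    (lie (nabla3 F) (nabla2 F) p).2.1
      = -(F p / pd F du1 p) + F p ^ 2 * pd (pd F du1) du1 p / pd F du1 p ^ 3 := by
  have e2 : (fun q => (nabla2 F q).2.1) = fun _ => (0 : ℝ) := rfl
  have e3 : (fun q => (nabla3 F q).2.1) = fun q => F q / pd F du1 q := rfl
  have dF : DifferentiableAt ℝ F p := hF.differentiable (by simp) p
  have dF1 : DifferentiableAt ℝ (pd F du1) p := (hF.pd du1).differentiable (by simp) p
  have hdiv : fderiv ℝ (fun q => F q / pd F du1 q) p du1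
      = (pd F du1 p * pd F du1 p - F p * pd (pd F du1) du1 p) / pd F du1 p ^ 2 := by
    have h := dF.hasFDerivAt.mul ((hasDerivAt_inv h1).comp_hasFDerivAt p dF1.hasFDerivAt)
    have e : (fun q => F q / pd F du1 q) = F * (Inv.inv ∘ pd F du1) :=
      funext fun q => div_eq_mul_inv _ _
    rw [e, h.fderiv]
    change F p * (-(pd F du1 p ^ 2)⁻¹ * pd (pd F du1) du1 p) + (pd F du1 p)⁻¹ * pd F du1 p = _
    field_simp
    ring
  rw [lie, Prod.snd_sub, Prod.fst_sub, fderiv_snd_comp_apply h2, fderiv_snd_comp_apply h3,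
    fderiv_fst_comp_apply h2.snd, fderiv_fst_comp_apply h3.snd, e2, e3,
    nabla2_eq_smul, map_smul, hdiv]
  simp
  field_simp
  ring

/-- on an open set where `F ≠ 0`, `F_{u₁} ≠ 0`, `F_{u₁u₁} ≠ 0` and
`u₁·F_{u₁} − F ≠ 0`, there is a smooth function `L` such that
`[∇₃^F, ∇₂^F] = −∇₃^F + J^F·∇₁^F + L·∇₂^F`, with
`J^F = F²·F_{u₁u₁}/((u₁·F_{u₁} − F)·F_{u₁}²)`. -/
theorem commutator_nabla3_nabla2
    (F : ℝ × ℝ × ℝ → ℝ) (hF : ContDiff ℝ (⊤ : ℕ∞) F)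
    (D : Set (ℝ × ℝ × ℝ)) (hD : IsOpen D)
    (h0 : ∀ p ∈ D, F p ≠ 0)
    (h1 : ∀ p ∈ D, pd F du1 p ≠ 0)
    (h2 : ∀ p ∈ D, pd (pd F du1) du1 p ≠ 0)
    (h3 : ∀ p ∈ D, p.2.2 * pd F du1 p - F p ≠ 0) :
    ∃ L : ℝ × ℝ × ℝ → ℝ, ContDiffOn ℝ (⊤ : ℕ∞) L D ∧
      ∀ p ∈ D,
        lie (nabla3 F) (nabla2 F) p
          = -nabla3 F p + Jinv F p • nabla1 F p + L p • nabla2 F p := by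
  have hn1 := contDiffOn_nabla1 hF h1
  have hn2 := contDiffOn_nabla2 hF h1
  have hn3 := contDiffOn_nabla3 hF h1 h2
  have hJ := contDiffOn_Jinv hF h1 h3
  have hR := (contDiffOn_lie hD hn3 hn2).add (hn3.sub (hJ.smul hn1))
  refine ⟨fun p => (lie (nabla3 F) (nabla2 F) p + (nabla3 F p - Jinv F p • nabla1 F p)).2.2
    * pd F du1 p / F p, (hR.snd.snd.mul (hF.pd du1).contDiffOn).div hF.contDiffOn h0,
    fun p hp => ?_⟩
  have d2 := (hn2.differentiableOn (by simp) p hp).differentiableAt (hD.mem_nhds hp)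
  have d3 := (hn3.differentiableOn (by simp) p hp).differentiableAt (hD.mem_nhds hp)
  have a0 := h0 p hp
  have a1 := h1 p hp
  have a3 := h3 p hp
  refine Prod.ext ?_ (Prod.ext ?_ ?_)
  · rw [lie_nabla3_nabla2_fst d3 d2 a1]
    simp [nabla1, nabla2, nabla3]
  · rw [lie_nabla3_nabla2_snd_fst hF d3 d2 a1]
    simp only [nabla1, nabla2, nabla3, Jinv, Prod.snd_add, Prod.fst_add, Prod.snd_neg,
      Prod.fst_neg, Prod.smul_snd, Prod.smul_fst, smul_eq_mul]
    have key : F p ^ 2 * pd (pd F du1) du1 p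
        / ((p.2.2 * pd F du1 p - F p) * pd F du1 p ^ 2)
        * ((p.2.2 * pd F du1 p - F p) / pd F du1 p)
        = F p ^ 2 * pd (pd F du1) du1 p / pd F du1 p ^ 3 := by
      generalize p.2.2 * pd F du1 p - F p = d at a3
      field_simp
    rw [key]
    ring
  · have e2 : (nabla2 F p).2.2 = F p / pd F du1 p := rfl
    simp only [Prod.snd_add, Prod.snd_sub, Prod.snd_neg, Prod.smul_snd, smul_eq_mul, e2]
    field_simp
    ring
end
end
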